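/- Let r ≥ 1, let Γ₀ ≤ Γ₁ be subgroups of SL(2,ℝ) with Γ₀ of finite index in Γ₁, let ρ : Γ₁ →* (Fin r → SL(2,ℝ)) be a group homomorphism into the product group, and let L ≥ 0. Suppose there exists a map u₀ : ℍ → (Fin r → ℍ) which is L-Lipschitz for the hyperbolic metric on ℍ and the supremum metric on Fin r → ℍ, and which is ρ-equivariant with respect to Γ₀, i.e. (u₀ (γ • z)) i = (ρ(γ) i) • (u₀ z) i for all γ ∈ Γ₀, z ∈ ℍ and i. Then there exists a map u : ℍ → (Fin r → ℍ) which is L-Lipschitz and ρ-equivariant with respect to all of Γ₁. -/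

import Mathlib

open scoped UpperHalfPlane MatrixGroups
namespace UpperHalfPlane

open Real

/-- `p` minimizes the sum of the hyperbolic cosines of the distances to the points `x j`;
in the hyperboloid model this is the normalized sum of the `x j`. -/
def IsCoshCenter {ι : Type*} [Fintype ι] (p : ℍ) (x : ι → ℍ) : Prop :=
  ∀ q : ℍ, ∑ j, cosh (dist p (x j)) ≤ ∑ j, cosh (dist q (x j))

/-- The sinh of the signed distance from `z` to the geodesic `‖z‖ = m`. -/
noncomputable def sinhDistCircle (m : ℝ) (z : ℍ) : ℝ :=
  (z.re ^ 2 + z.im ^ 2 - m ^ 2) / (2 * m * z.im)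

section

variable {ι : Type*} [Fintype ι]

theorem exists_isCoshCenter [Nonempty ι] (x : ι → ℍ) : ∃ p, IsCoshCenter p x := by
  have hcont : Continuous fun q : ℍ => ∑ j, cosh (dist q (x j)) := by fun_prop
  obtain ⟨j₀⟩ := ‹Nonempty ι›
  refine hcont.exists_forall_le (Filter.tendsto_atTop_mono (fun q => ?_)
    (tendsto_dist_right_cocompact_atTop (x j₀)))
  calc dist q (x j₀) ≤ sinh (dist q (x j₀)) := self_le_sinh_iff.2 dist_nonneg
    _ ≤ cosh (dist q (x j₀)) := (sinh_lt_cosh _).le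
    _ ≤ ∑ j, cosh (dist q (x j)) :=
      Finset.single_le_sum (f := fun j => cosh (dist q (x j)))
        (fun j _ => (cosh_pos _).le) (Finset.mem_univ j₀)

theorem IsCoshCenter.smul {p : ℍ} {x : ι → ℍ} (h : IsCoshCenter p x) (g : SL(2, ℝ)) :
    IsCoshCenter (g • p) (fun j => g • x j) := by
  intro q
  have := h (g⁻¹ • q)
  simpa only [dist_smul, ← dist_smul g (g⁻¹ • q), smul_inv_smul] using this

theorem IsCoshCenter.comp_equiv {κ : Type*} [Fintype κ] {p : ℍ} {x : ι → ℍ}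
    (h : IsCoshCenter p x) (e : κ ≃ ι) : IsCoshCenter p (x ∘ e) := by
  intro q
  calc ∑ k, cosh (dist p (x (e k))) = ∑ j, cosh (dist p (x j)) :=
        e.sum_comp fun j => cosh (dist p (x j))
    _ ≤ ∑ j, cosh (dist q (x j)) := h q
    _ = ∑ k, cosh (dist q (x (e k))) := (e.sum_comp fun j => cosh (dist q (x j))).symm

theorem IsCoshCenter.sum_sinhDistCircle_eq_zero {p : ℍ} {x : ι → ℍ} (h : IsCoshCenter p x)
    (hp : p.re = 0) : ∑ j, sinhDistCircle p.im (x j) = 0 := by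
  set α := ∑ j, ((x j).re ^ 2 + (x j).im ^ 2) / (2 * (x j).im) with hα
  set β := ∑ j, 1 / (2 * (x j).im) with hβ
  have hsum (q : ℍ) (hq : q.re = 0) :
      ∑ j, cosh (dist q (x j)) = α / q.im + q.im * β := by
    rw [hα, hβ, Finset.sum_div, Finset.mul_sum, ← Finset.sum_add_distrib]
    refine Finset.sum_congr rfl fun j _ => ?_
    have := q.im_pos
    have := (x j).im_pos
    rw [cosh_dist', hq]
    field_simp
    ring
  have key (t : ℝ) (ht : 0 < t) : α / p.im + p.im * β ≤ α / t + t * β := by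
    have := h ⟨⟨0, t⟩, ht⟩
    rwa [hsum p hp, hsum _ rfl] at this
  have hm := p.im_pos
  have hF : ∑ j, sinhDistCircle p.im (x j) = α / p.im - p.im * β := by
    rw [hα, hβ, Finset.sum_div, Finset.mul_sum, ← Finset.sum_sub_distrib]
    refine Finset.sum_congr rfl fun j _ => ?_
    have := (x j).im_pos
    rw [sinhDistCircle]
    field_simp
  rw [hF]
  rcases isEmpty_or_nonempty ι with hι | hι
  · simp [hα, hβ]
  have hαpos : 0 < α := Finset.sum_pos (fun j _ => by
    have := (x j).im_pos; positivity) Finset.univ_nonempty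
  have hβpos : 0 < β := Finset.sum_pos (fun j _ => by
    have := (x j).im_pos; positivity) Finset.univ_nonempty
  have hαs := mul_self_sqrt hαpos.le
  have hβs := mul_self_sqrt hβpos.le
  have ha := sqrt_pos.2 hαpos
  have hb := sqrt_pos.2 hβpos
  generalize √α = a at *
  generalize √β = b at *
  have h1 := key (a / b) (by positivity)
  rw [← hαs, ← hβs] at h1 ⊢
  have h2 : a * a / (a / b) + a / b * (b * b) = 2 * a * b := by field_simp; ring
  rw [h2] at h1
  have h3 : (a - p.im * b) ^ 2 ≤ 0 := by
    have h4 : a * a / p.im + p.im * (b * b) - 2 * a * b = (a - p.im * b) ^ 2 / p.im := by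
      field_simp
      ring
    have h5 : (a - p.im * b) ^ 2 / p.im ≤ 0 := by linarith
    rwa [div_le_iff₀ hm, zero_mul] at h5
  have h6 : a = p.im * b := by nlinarith
  rw [h6]
  field_simp
  ring

end

theorem abs_arsinh_sinhDistCircle_sub_le_dist {m : ℝ} (hm : 0 < m) (z w : ℍ) :
    |arsinh (sinhDistCircle m z) - arsinh (sinhDistCircle m w)| ≤ dist z w := by
  rw [← abs_of_nonneg (dist_nonneg (x := z) (y := w)), ← cosh_le_cosh, cosh_sub,
    sinh_arsinh, sinh_arsinh, cosh_arsinh, cosh_arsinh, sub_le_iff_le_add, cosh_dist',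
    ← sqrt_mul (by positivity), sinhDistCircle, sinhDistCircle]
  have hz := z.im_pos
  have hw := w.im_pos
  generalize z.re = a, z.im = b, w.re = c, w.im = d at *
  have hT {a b : ℝ} (hb : 0 < b) : 1 + ((a ^ 2 + b ^ 2 - m ^ 2) / (2 * m * b)) ^ 2 =
      ((a ^ 2 + b ^ 2 + m ^ 2) / (2 * m * b)) ^ 2 - (a / b) ^ 2 := by
    field_simp
    ring
  have hlt {a b : ℝ} (hb : 0 < b) : |a / b| ≤ (a ^ 2 + b ^ 2 + m ^ 2) / (2 * m * b) := by
    refine abs_le_of_sq_le_sq ?_ (by positivity)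
    have := hT (a := a) hb
    nlinarith [sq_nonneg ((a ^ 2 + b ^ 2 - m ^ 2) / (2 * m * b))]
  have hc : ((a - c) ^ 2 + b ^ 2 + d ^ 2) / (2 * b * d) +
      (a ^ 2 + b ^ 2 - m ^ 2) / (2 * m * b) * ((c ^ 2 + d ^ 2 - m ^ 2) / (2 * m * d)) =
      (a ^ 2 + b ^ 2 + m ^ 2) / (2 * m * b) * ((c ^ 2 + d ^ 2 + m ^ 2) / (2 * m * d)) -
      a / b * (c / d) := by
    field_simp
    ring
  rw [hc, hT hz, hT hw]
  have h1 := hlt (a := a) hz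
  have h2 := hlt (a := c) hw
  generalize (a ^ 2 + b ^ 2 + m ^ 2) / (2 * m * b) = T,
    (c ^ 2 + d ^ 2 + m ^ 2) / (2 * m * d) = T', a / b = S, c / d = S' at *
  refine sqrt_le_iff.2 ⟨?_, ?_⟩
  · have := mul_le_mul h1 h2 (abs_nonneg _) ((abs_nonneg _).trans h1)
    rw [← abs_mul] at this
    linarith [le_abs_self (S * S')]
  · nlinarith [sq_nonneg (T * S' - S * T')]

theorem sinhDistCircle_mul_exp_le {m : ℝ} (hm : 0 < m) {t : ℝ} (ht : 0 ≤ t) (z : ℍ) :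
    sinhDistCircle (m * exp t) z ≤ sinh (arsinh (sinhDistCircle m z) - t) := by
  have hz := z.im_pos
  have hT : √(1 + sinhDistCircle m z ^ 2) ≤ (z.re ^ 2 + z.im ^ 2 + m ^ 2) / (2 * m * z.im) := by
    refine sqrt_le_iff.2 ⟨by positivity, ?_⟩
    have : ((z.re ^ 2 + z.im ^ 2 + m ^ 2) / (2 * m * z.im)) ^ 2 =
      1 + sinhDistCircle m z ^ 2 + (z.re / z.im) ^ 2 := by
      rw [sinhDistCircle]
      field_simp
      ring
    nlinarith [sq_nonneg (z.re / z.im)]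
  have hk : sinhDistCircle (m * exp t) z = sinhDistCircle m z * cosh t -
      (z.re ^ 2 + z.im ^ 2 + m ^ 2) / (2 * m * z.im) * sinh t := by
    rw [sinhDistCircle, sinhDistCircle, cosh_eq, sinh_eq, exp_neg]
    have := exp_pos t
    field_simp
    ring
  rw [sinh_sub, sinh_arsinh, cosh_arsinh, hk]
  have := mul_le_mul_of_nonneg_right hT (sinh_nonneg_iff.2 ht)
  linarith

theorem smul_re_eq_zero {g : SL(2, ℝ)} {z : ℍ}
    (h : (g 0 0 * z.re + g 0 1) * (g 1 0 * z.re + g 1 1) + g 0 0 * g 1 0 * z.im ^ 2 = 0) :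
    (g • z).re = 0 := by
  rw [← coe_re, coe_specialLinearGroup_apply, Complex.div_re, ← add_div]
  refine div_eq_zero_iff.2 (.inl ?_)
  simp
  linear_combination h

/-- Any two points lie on a geodesic, which can be moved to the imaginary axis. -/
theorem exists_smul_re_eq_zero (p q : ℍ) :
    ∃ g : SL(2, ℝ), (g • p).re = 0 ∧ (g • q).re = 0 := by
  by_cases hpq : p.re = q.re
  · refine ⟨⟨!![1, -p.re; 0, 1], by simp⟩, smul_re_eq_zero ?_, smul_re_eq_zero ?_⟩ <;>
      simp [hpq]
  have hsub : p.re - q.re ≠ 0 := sub_ne_zero.2 hpq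
  obtain ⟨c, hc⟩ : ∃ c, (p.re - c) ^ 2 + p.im ^ 2 = (q.re - c) ^ 2 + q.im ^ 2 := by
    refine ⟨(p.re ^ 2 + p.im ^ 2 - q.re ^ 2 - q.im ^ 2) / (2 * (p.re - q.re)), ?_⟩
    field_simp
    ring
  have hp := p.im_pos
  obtain ⟨R, hR, hRp⟩ : ∃ R > 0, R ^ 2 = (p.re - c) ^ 2 + p.im ^ 2 :=
    ⟨√((p.re - c) ^ 2 + p.im ^ 2), by positivity, sq_sqrt (by positivity)⟩
  obtain ⟨s, hs⟩ : ∃ s : ℝ, s * s * (2 * R) = 1 :=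
    ⟨√(1 / (2 * R)), by rw [mul_self_sqrt (by positivity)]; field_simp⟩
  refine ⟨⟨!![s, -s * (c - R); -s, s * (c + R)], ?_⟩, smul_re_eq_zero ?_, smul_re_eq_zero ?_⟩
  · rw [Matrix.det_fin_two_of]
    linear_combination hs
  · simp
    linear_combination s ^ 2 * hRp
  · simp
    linear_combination s ^ 2 * (hRp + hc)

theorem IsCoshCenter.dist_le_of_im_le {ι : Type*} [Fintype ι] [Nonempty ι] {p q : ℍ}
    {x y : ι → ℍ} (hp : IsCoshCenter p x) (hq : IsCoshCenter q y) {D : ℝ}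
    (hD : ∀ j, dist (x j) (y j) ≤ D) (hp₀ : p.re = 0) (hq₀ : q.re = 0) (him : p.im ≤ q.im) :
    dist p q ≤ D := by
  by_contra! hlt
  set t := log q.im - log p.im
  have ht : 0 ≤ t := sub_nonneg.2 (log_le_log p.im_pos him)
  have hdist : dist p q = t := by
    rw [dist_of_re_eq (hp₀.trans hq₀.symm), dist_comm, Real.dist_eq, abs_of_nonneg ht]
  have hqp : q.im = p.im * exp t := by
    rw [exp_sub, exp_log q.im_pos, exp_log p.im_pos, mul_div_cancel₀ _ p.im_pos.ne']
  have hsum : ∑ j, sinhDistCircle q.im (y j) < ∑ j, sinhDistCircle p.im (x j) := by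
    refine Finset.sum_lt_sum_of_nonempty Finset.univ_nonempty fun j _ => ?_
    calc sinhDistCircle q.im (y j) ≤ sinh (arsinh (sinhDistCircle p.im (y j)) - t) :=
          hqp ▸ sinhDistCircle_mul_exp_le p.im_pos ht (y j)
      _ < sinh (arsinh (sinhDistCircle p.im (x j))) := by
          have := (abs_le.1 (abs_arsinh_sinhDistCircle_sub_le_dist p.im_pos (x j) (y j))).1
          have := hD j
          exact sinh_lt_sinh.2 (by linarith)
      _ = sinhDistCircle p.im (x j) := sinh_arsinh _
  rw [hp.sum_sinhDistCircle_eq_zero hp₀, hq.sum_sinhDistCircle_eq_zero hq₀] at hsum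
  exact hsum.false

/-- The center is a nonexpanding function of the points, for the supremum metric. -/
theorem IsCoshCenter.dist_le {ι : Type*} [Fintype ι] [Nonempty ι] {p q : ℍ} {x y : ι → ℍ}
    (hp : IsCoshCenter p x) (hq : IsCoshCenter q y) {D : ℝ} (hD : ∀ j, dist (x j) (y j) ≤ D) :
    dist p q ≤ D := by
  obtain ⟨g, hgp, hgq⟩ := exists_smul_re_eq_zero p q
  rw [← dist_smul g]
  have hD' (j) : dist (g • x j) (g • y j) ≤ D := by
    rw [dist_smul]
    exact hD j
  rcases le_total (g • p).im (g • q).im with h | h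
  · exact (hp.smul g).dist_le_of_im_le (hq.smul g) hD' hgp hgq h
  · rw [dist_comm]
    exact (hq.smul g).dist_le_of_im_le (hp.smul g) (fun j => dist_comm (g • x j) _ ▸ hD' j)
      hgq hgp h

theorem IsCoshCenter.unique {ι : Type*} [Fintype ι] [Nonempty ι] {p q : ℍ} {x : ι → ℍ}
    (hp : IsCoshCenter p x) (hq : IsCoshCenter q x) : p = q :=
  dist_le_zero.1 (hp.dist_le hq fun j => (dist_self (x j)).le)

end UpperHalfPlane

/-- Componentwise center-of-mass averaging over cosets: an `L`-Lipschitz map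
`ℍ → ℍ^r` which is `ρ`-equivariant with respect to a finite index subgroup `Γ₀` of
`Γ₁` can be replaced by an `L`-Lipschitz map which is `ρ`-equivariant with respect
to all of `Γ₁`.  Here `Fin r → ℍ` carries the supremum (Kobayashi) metric. -/
theorem exists_equivariant_lipschitz_of_finite_index_product
    (r : ℕ) (hr : 1 ≤ r)
    (Γ₀ Γ₁ : Subgroup SL(2, ℝ)) (hle : Γ₀ ≤ Γ₁)
    (hfi : (Γ₀.subgroupOf Γ₁).FiniteIndex)
    (ρ : Γ₁ →* (Fin r → SL(2, ℝ))) (L : ℝ) (hL : 0 ≤ L)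
    (u₀ : ℍ → (Fin r → ℍ))
    (hu₀Lip : ∀ z w : ℍ, dist (u₀ z) (u₀ w) ≤ L * dist z w)
    (hu₀equiv : ∀ γ : Γ₁, (γ : SL(2, ℝ)) ∈ Γ₀ → ∀ z : ℍ, ∀ i : Fin r,
      u₀ ((γ : SL(2, ℝ)) • z) i = (ρ γ i) • (u₀ z i)) :
    ∃ u : ℍ → (Fin r → ℍ),
      (∀ z w : ℍ, dist (u z) (u w) ≤ L * dist z w) ∧
      (∀ γ : Γ₁, ∀ z : ℍ, ∀ i : Fin r,
        u ((γ : SL(2, ℝ)) • z) i = (ρ γ i) • (u z i)) := by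
  let H := Γ₀.subgroupOf Γ₁
  let _ : Fintype (Γ₁ ⧸ H) := H.fintypeQuotientOfFiniteIndex
  let v (g : Γ₁) (z : ℍ) (i : Fin r) : ℍ := ρ g i • u₀ (((g⁻¹ : Γ₁) : SL(2, ℝ)) • z) i
  have hv_congr (g h : Γ₁) (hgh : (g : Γ₁ ⧸ H) = h) : v g = v h := by
    obtain ⟨k, hk, rfl⟩ : ∃ k ∈ H, h = g * k :=
      ⟨g⁻¹ * h, QuotientGroup.eq.1 hgh, (mul_inv_cancel_left g h).symm⟩
    funext z i
    have := hu₀equiv k⁻¹ (inv_mem (Subgroup.mem_subgroupOf.1 hk)) ((g⁻¹ : Γ₁) • z) i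
    simp only [v, mul_inv_rev, Subgroup.coe_mul, mul_smul, map_mul, Pi.mul_apply]
    rw [← Subgroup.smul_def g⁻¹, this, map_inv, Pi.inv_apply, smul_inv_smul]
  have hv_smul (γ g : Γ₁) (z : ℍ) (i : Fin r) :
      v g ((γ : SL(2, ℝ)) • z) i = ρ γ i • v (γ⁻¹ * g) z i := by
    simp only [v, map_mul, map_inv, Pi.mul_apply, Pi.inv_apply, mul_smul, smul_inv_smul,
      mul_inv_rev, inv_inv, Subgroup.coe_mul]
  let x (z : ℍ) (i : Fin r) (c : Γ₁ ⧸ H) : ℍ := v c.out z i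
  choose u hu using fun z i => UpperHalfPlane.exists_isCoshCenter (x z i)
  refine ⟨u, fun z w => ?_, fun γ z i => ?_⟩
  · refine (dist_pi_le_iff (mul_nonneg hL dist_nonneg)).2 fun i =>
      (hu z i).dist_le (hu w i) fun c => ?_
    have := (dist_le_pi_dist _ _ i).trans
      (hu₀Lip (((c.out⁻¹ : Γ₁) : SL(2, ℝ)) • z) (((c.out⁻¹ : Γ₁) : SL(2, ℝ)) • w))
    rw [dist_smul] at this
    simpa only [x, v, dist_smul] using this
  · have hx : x ((γ : SL(2, ℝ)) • z) i =
        (fun c => ρ γ i • x z i c) ∘ MulAction.toPerm (γ⁻¹ : Γ₁) := by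
      funext c
      simp only [x, hv_smul, Function.comp_apply, MulAction.toPerm_apply]
      rw [hv_congr (γ⁻¹ * c.out) (γ⁻¹ • c).out]
      rw [QuotientGroup.out_eq', ← smul_eq_mul, ← MulAction.Quotient.smul_coe,
        QuotientGroup.out_eq']
    refine (hu _ i).unique ?_
    rw [hx]
    exact ((hu z i).smul (ρ γ i)).comp_equiv _
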